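/- Assume the structure hypotheses (H), suppose G can be tiled with K_{s,t}, and let ℱ be a K_{s,t}-tiling of G. For i = 1,2 let ℱ_i = {K ∈ ℱ : V(K) ∩ (U_i ∪ V_i) ≠ ∅}, let U_i* be the set of vertices of U contained in some member of ℱ_i, and let V_i* be the set of vertices of V contained in some member of ℱ_i. Then for each i ∈ {1,2}, either max{|U_i*|, |V_i*|} ≥ k(s+t) + 2t, or min{|U_i*|, |V_i*|} ≥ (k+1)(s+t). -/

import Mathlib

open scoped Classical
open Finset

namespace PaperTiling

variable {V : Type*} [Fintype V] [DecidableEq V]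

/-- The number of neighbours of `v` inside the set `S`. -/
noncomputable def degS (G : SimpleGraph V) (v : V) (S : Finset V) : ℕ :=
  (S.filter fun w => G.Adj v w).card

/-- The number of edges of `G` with one end in `A` and the other in `B`. -/
noncomputable def eAB (G : SimpleGraph V) (A B : Finset V) : ℕ :=
  ∑ v ∈ A, degS G v B

/-- The edge density `d(A,B) = e(A,B)/(|A||B|)`. -/
noncomputable def dens (G : SimpleGraph V) (A B : Finset V) : ℝ :=
  (eAB G A B : ℝ) / ((A.card : ℝ) * (B.card : ℝ))

/-- `G` is a bipartite graph with parts `A` and `B`. -/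
def IsBipartition (G : SimpleGraph V) (A B : Finset V) : Prop :=
  Disjoint A B ∧ A ∪ B = Finset.univ ∧
    ∀ u v : V, G.Adj u v → (u ∈ A ∧ v ∈ B) ∨ (u ∈ B ∧ v ∈ A)

/-- `(S, T)` spans a copy of the complete bipartite graph `K_{s,t}` in `G`,
with `S` the side of size `s` and `T` the side of size `t`. -/
def IsKst (G : SimpleGraph V) (s t : ℕ) (S T : Finset V) : Prop :=
  Disjoint S T ∧ S.card = s ∧ T.card = t ∧ ∀ u ∈ S, ∀ v ∈ T, G.Adj u v

/-- `𝒯` is a perfect `K_{s,t}`-tiling of `G`: a collection of pairwise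
vertex-disjoint copies of `K_{s,t}` covering all vertices. -/
def IsKstTiling (G : SimpleGraph V) (s t : ℕ)
    (𝒯 : Finset (Finset V × Finset V)) : Prop :=
  (∀ P ∈ 𝒯, IsKst G s t P.1 P.2) ∧
  (𝒯 : Set (Finset V × Finset V)).PairwiseDisjoint (fun P => P.1 ∪ P.2) ∧
  𝒯.sup (fun P => P.1 ∪ P.2) = Finset.univ

/-- `G` can be tiled with `K_{s,t}`. -/
def KstTileable (G : SimpleGraph V) (s t : ℕ) : Prop :=
  ∃ 𝒯 : Finset (Finset V × Finset V), IsKstTiling G s t 𝒯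

/-- `G` can be tiled with the complete graph `K_s`. -/
def CliqueTileable (G : SimpleGraph V) (s : ℕ) : Prop :=
  ∃ 𝒞 : Finset (Finset V),
    (∀ S ∈ 𝒞, S.card = s ∧ G.IsClique (S : Set V)) ∧
    (𝒞 : Set (Finset V)).PairwiseDisjoint id ∧
    𝒞.sup id = Finset.univ

/-- The minimum degree of `G` equals the real number `c`. -/
def MinDegreeIs (G : SimpleGraph V) (c : ℝ) : Prop :=
  (∀ v : V, c ≤ (degS G v Finset.univ : ℝ)) ∧
  ∃ v : V, (degS G v Finset.univ : ℝ) = c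

/-- `(c, L)` is an `h`-star with centre `c ∈ A` and `h` leaves `L ⊆ B`. -/
def IsStar (G : SimpleGraph V) (h : ℕ) (A B : Finset V) (c : V) (L : Finset V) : Prop :=
  c ∈ A ∧ L ⊆ B ∧ L.card = h ∧ ∀ v ∈ L, G.Adj c v

/-- `𝒮` is a family of pairwise vertex-disjoint `h`-stars from `A` to `B`. -/
def StarFamily (G : SimpleGraph V) (h : ℕ) (A B : Finset V)
    (𝒮 : Finset (V × Finset V)) : Prop :=
  (∀ S ∈ 𝒮, IsStar G h A B S.1 S.2) ∧
  (𝒮 : Set (V × Finset V)).PairwiseDisjoint (fun S => insert S.1 S.2)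

/-- The structure hypotheses (H) for the extremal construction of the paper:
`1 ≤ s < t`, `t ≥ 2s+1`, `k ≥ 1`, `G` is bipartite with parts
`U₀ ∪ U₁ ∪ U₂` and `V₀ ∪ V₁ ∪ V₂`, with the prescribed part sizes,
complete pairs `(U₁,V₁)`, `(U₂,V₂)`, `(U₀, V₁∪V₂)`, `(V₀, U₁∪U₂)`,
no edges between `U₀` and `V₀`, and sparse `K_{2,2}`-free diagonal pairs. -/
structure StructH (G : SimpleGraph V) (s t k : ℕ)
    (U0 U1 U2 V0 V1 V2 : Finset V) : Prop where
  hs : 1 ≤ s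
  hst : s < t
  ht : 2 * s + 1 ≤ t
  hk : 1 ≤ k
  bip : IsBipartition G (U0 ∪ U1 ∪ U2) (V0 ∪ V1 ∪ V2)
  hU01 : Disjoint U0 U1
  hU02 : Disjoint U0 U2
  hU12 : Disjoint U1 U2
  hV01 : Disjoint V0 V1
  hV02 : Disjoint V0 V2
  hV12 : Disjoint V1 V2
  cardU0 : U0.card = s - 1
  cardV0 : V0.card = s - 1
  cardU1 : U1.card = k * (s + t) + (t + 1) / 2
  cardV2 : V2.card = k * (s + t) + (t + 1) / 2
  cardV1 : V1.card = k * (s + t) + (t + 2) / 2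
  cardU2 : U2.card = k * (s + t) + (t + 2) / 2
  compU1V1 : ∀ u ∈ U1, ∀ v ∈ V1, G.Adj u v
  compU2V2 : ∀ u ∈ U2, ∀ v ∈ V2, G.Adj u v
  compU0 : ∀ u ∈ U0, ∀ v ∈ V1 ∪ V2, G.Adj u v
  compV0 : ∀ v ∈ V0, ∀ u ∈ U1 ∪ U2, G.Adj u v
  emptyU0V0 : ∀ u ∈ U0, ∀ v ∈ V0, ¬ G.Adj u v
  K22freeU1V2 : ∀ S T : Finset V, S ⊆ U1 → T ⊆ V2 → ¬ IsKst G 2 2 S T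
  K22freeU2V1 : ∀ S T : Finset V, S ⊆ U2 → T ⊆ V1 → ¬ IsKst G 2 2 S T
  degU1 : ∀ u ∈ U1, degS G u V2 ≤ s - 1
  degU2 : ∀ u ∈ U2, degS G u V1 ≤ s - 1
  degV1 : ∀ v ∈ V1, degS G v U2 ≤ s - 1
  degV2 : ∀ v ∈ V2, degS G v U1 ≤ s - 1

/-- The vertex set `W` of a copy of `K_{s,t}` is crossing. -/
def Crossing (U1 V1 U2 V2 W : Finset V) : Prop :=
  (W ∩ (U1 ∪ V1)).Nonempty ∧ (W ∩ (U2 ∪ V2)).Nonempty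

/-- `W` is crossing from the set `A`, where `AD = A^D` is the diagonal set of `A`
and `AM = A^M` is the opposite middle set of `A`. -/
def CrossingFrom (W A AD AM : Finset V) : Prop :=
  (W ∩ A).card = 1 ∧
    (2 ≤ (W ∩ AD).card ∨ ((W ∩ AD).card = 1 ∧ (W ∩ AM).Nonempty))

/-- `W` is of Type 1 (crossing from `A`), where `AD = A^D`, `AN = A^N`,
`ANM = (A^N)^M`. -/
def Type1From (s t : ℕ) (W AD AN ANM : Finset V) : Prop :=
  ∃ p : ℕ, 2 ≤ p ∧ p ≤ s - 1 ∧ (W ∩ ANM).card = s - 1 ∧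
    (W ∩ AN).card = t - p ∧ (W ∩ AD).card = p

/-- `W` is of Type 2 (crossing from `A`), where `AD = A^D`, `AM = A^M`,
`AND = (A^N)^D`. -/
def Type2From (s t : ℕ) (W AD AM AND : Finset V) : Prop :=
  ∃ p : ℕ, 1 ≤ p ∧ p ≤ s - 1 ∧ (W ∩ AND).card = t - 1 ∧
    (W ∩ AM).card = s - p ∧ (W ∩ AD).card = p

/-- Two numbers `a * s + b * t` and `a * t + b * s` that both exceed `k * (s + t) + s`, where
`b ≤ k` and `s < t`, satisfy `k * (s + t) + 2 * t ≤ a * t + b * s`. -/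
lemma le_mul_add_mul_of_le {s t k a b : ℕ} (hst : s < t) (hb : b ≤ k)
    (hX : k * (s + t) + s < a * s + b * t) :
    k * (s + t) + 2 * t ≤ a * t + b * s := by
  obtain ⟨d, rfl⟩ := Nat.exists_eq_add_of_lt hst
  obtain ⟨j, rfl⟩ := Nat.exists_eq_add_of_le hb
  have ha : b + 2 * j + 2 ≤ a := by
    by_contra! h
    have h1 : a * s ≤ (b + 2 * j + 1) * s := Nat.mul_le_mul_right s (by omega)
    nlinarith [Nat.zero_le (j * d)]
  obtain ⟨i, rfl⟩ := Nat.exists_eq_add_of_le ha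
  nlinarith [Nat.zero_le (j * d), Nat.zero_le (i * d), Nat.zero_le (i * s)]

lemma le_max_or_le_min {s t k a b : ℕ} (hst : s < t)
    (hX : k * (s + t) + s < a * s + b * t) (hY : k * (s + t) + s < a * t + b * s) :
    k * (s + t) + 2 * t ≤ max (a * s + b * t) (a * t + b * s) ∨
      (k + 1) * (s + t) ≤ min (a * s + b * t) (a * t + b * s) := by
  rcases le_or_gt b k with hb | hb
  · exact .inl (le_max_of_le_right (le_mul_add_mul_of_le hst hb hX))
  rcases le_or_gt a k with ha | ha
  · have := le_mul_add_mul_of_le (a := b) hst ha (by omega)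
    exact .inl (le_max_of_le_left (by omega))
  · have hs := Nat.mul_le_mul_right s ha
    have ht := Nat.mul_le_mul_right t hb
    have hs' := Nat.mul_le_mul_right s hb
    have ht' := Nat.mul_le_mul_right t ha
    simp only [Nat.succ_eq_add_one] at hs ht hs' ht'
    exact .inr (le_min (by linarith) (by linarith))

lemma IsBipartition.symm {G : SimpleGraph V} {A B : Finset V} (h : IsBipartition G A B) :
    IsBipartition G B A :=
  ⟨h.1.symm, by rw [union_comm]; exact h.2.1, fun u v huv => (h.2.2 u v huv).symm⟩

lemma IsBipartition.subset_of_isKst {G : SimpleGraph V} {A B S T : Finset V} {s t : ℕ}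
    (hAB : IsBipartition G A B) (hs : 0 < s) (ht : 0 < t) (h : IsKst G s t S T) :
    S ⊆ A ∧ T ⊆ B ∨ S ⊆ B ∧ T ⊆ A := by
  obtain ⟨-, hS, hT, hadj⟩ := h
  obtain ⟨u₀, hu₀⟩ := card_pos.1 (hS ▸ hs)
  obtain ⟨v₀, hv₀⟩ := card_pos.1 (hT ▸ ht)
  have hd : ∀ x, x ∈ A → x ∉ B := fun x hA hB => disjoint_left.1 hAB.1 hA hB
  have key : ∀ u ∈ S, ∀ v ∈ T, (u ∈ A ∧ v ∈ B) ∨ (u ∈ B ∧ v ∈ A) :=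
    fun u hu v hv => hAB.2.2 u v (hadj u hu v hv)
  simp only [subset_iff]
  rcases key u₀ hu₀ v₀ hv₀ with h₀ | h₀
  · exact .inl ⟨fun u hu => by grind, fun v hv => by grind⟩
  · exact .inr ⟨fun u hu => by grind, fun v hv => by grind⟩

lemma IsBipartition.card_inter_of_isKst {G : SimpleGraph V} {A B S T : Finset V} {s t : ℕ}
    (hAB : IsBipartition G A B) (hs : 0 < s) (ht : 0 < t) (h : IsKst G s t S T) :
    ((S ∪ T) ∩ A).card = if S ⊆ A then s else t := by
  have hd := disjoint_left.1 hAB.1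
  split_ifs with hSA
  · have hTB : T ⊆ B := by
      obtain ⟨u, hu⟩ := card_pos.1 (h.2.1 ▸ hs)
      rcases hAB.subset_of_isKst hs ht h with h' | h'
      · exact h'.2
      · exact absurd (h'.1 hu) (hd (hSA hu))
    rw [← h.2.1]
    congr 1
    grind
  · rcases hAB.subset_of_isKst hs ht h with h' | h'
    · exact absurd h'.1 hSA
    rw [← h.2.2.1]
    congr 1
    grind

/-- The two sides of the vertex set covered by disjoint copies of `K_{s,t}` in a bipartite graph,
`a` of them in one orientation and `b` in the other, have `a * s + b * t` and `a * t + b * s`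
vertices. -/
lemma IsBipartition.exists_card_biUnion_inter {G : SimpleGraph V} {A B : Finset V} {s t : ℕ}
    (hAB : IsBipartition G A B) (hs : 0 < s) (ht : 0 < t) {F : Finset (Finset V × Finset V)}
    (hF : ∀ P ∈ F, IsKst G s t P.1 P.2)
    (hdisj : (F : Set (Finset V × Finset V)).PairwiseDisjoint fun P => P.1 ∪ P.2) :
    ∃ a b : ℕ, ((F.biUnion fun P => P.1 ∪ P.2) ∩ A).card = a * s + b * t ∧
      ((F.biUnion fun P => P.1 ∪ P.2) ∩ B).card = a * t + b * s := by
  have hcard (C : Finset V) : ((F.biUnion fun P => P.1 ∪ P.2) ∩ C).card =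
      ∑ P ∈ F, ((P.1 ∪ P.2) ∩ C).card := by
    rw [biUnion_inter, card_biUnion]
    exact fun P hP Q hQ hPQ =>
      (hdisj hP hQ hPQ).mono inter_subset_left inter_subset_left
  have hB : ∀ P ∈ F, ((P.1 ∪ P.2) ∩ B).card = if P.1 ⊆ A then t else s := by
    intro P hP
    rw [hAB.symm.card_inter_of_isKst hs ht (hF P hP)]
    obtain ⟨u, hu⟩ := card_pos.1 ((hF P hP).2.1 ▸ hs)
    have hd := disjoint_left.1 hAB.1
    rcases hAB.subset_of_isKst hs ht (hF P hP) with h | h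
    · rw [if_pos h.1, if_neg fun h' => hd (h.1 hu) (h' hu)]
    · rw [if_pos h.1, if_neg fun h' => hd (h' hu) (h.1 hu)]
  refine ⟨(F.filter fun P => P.1 ⊆ A).card, (F.filter fun P => ¬ P.1 ⊆ A).card, ?_, ?_⟩
  · rw [hcard, sum_congr rfl fun P hP => hAB.card_inter_of_isKst hs ht (hF P hP), sum_ite]
    simp
  · rw [hcard, sum_congr rfl hB, sum_ite]
    simp

/-- The copies of a `K_{s,t}`-tiling that meet `A' ∪ B'` cover many vertices on each side when
both `A'` and `B'` have more than `k * (s + t) + s` vertices. -/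
lemma IsKstTiling.le_max_or_le_min_card {G : SimpleGraph V} {A B A' B' : Finset V} {s t k : ℕ}
    {𝒯 : Finset (Finset V × Finset V)} (h𝒯 : IsKstTiling G s t 𝒯) (hAB : IsBipartition G A B)
    (hs : 0 < s) (hst : s < t) (hA : A' ⊆ A) (hB : B' ⊆ B)
    (hA' : k * (s + t) + s < A'.card) (hB' : k * (s + t) + s < B'.card)
    {F : Finset (Finset V × Finset V)}
    (hF : F = 𝒯.filter fun P => ((P.1 ∪ P.2) ∩ (A' ∪ B')).Nonempty) :
    k * (s + t) + 2 * t ≤ max ((F.biUnion fun P => P.1 ∪ P.2) ∩ A).card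
        ((F.biUnion fun P => P.1 ∪ P.2) ∩ B).card ∨
      (k + 1) * (s + t) ≤ min ((F.biUnion fun P => P.1 ∪ P.2) ∩ A).card
        ((F.biUnion fun P => P.1 ∪ P.2) ∩ B).card := by
  obtain ⟨hK, hdisj, hcov⟩ := h𝒯
  have hF𝒯 : F ⊆ 𝒯 := hF ▸ filter_subset _ _
  have hcover : A' ∪ B' ⊆ F.biUnion fun P => P.1 ∪ P.2 := by
    intro x hx
    have hx' : x ∈ 𝒯.sup fun P => P.1 ∪ P.2 := hcov ▸ mem_univ x
    obtain ⟨P, hP, hxP⟩ := mem_sup.1 hx'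
    exact mem_biUnion.2 ⟨P, hF ▸ mem_filter.2 ⟨hP, x, mem_inter.2 ⟨hxP, hx⟩⟩, hxP⟩
  have hcA := card_le_card (subset_inter (subset_union_left.trans hcover) hA)
  have hcB := card_le_card (subset_inter (subset_union_right.trans hcover) hB)
  obtain ⟨a, b, ha, hb⟩ := hAB.exists_card_biUnion_inter hs (hs.trans hst)
    (fun P hP => hK P (hF𝒯 hP)) (hdisj.subset (coe_subset.2 hF𝒯))
  rw [ha] at hcA ⊢
  rw [hb] at hcB ⊢
  exact le_max_or_le_min hst (hA'.trans_le hcA) (hB'.trans_le hcB)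

/-- Claim 3.5: under the structure hypotheses (H), for any
`K_{s,t}`-tiling `𝒯` of `G` and `i = 1,2`, with `ℱ_i` the copies touching
`U_i ∪ V_i` and `U_i*`, `V_i*` the vertices of `U`, `V` they cover, either
`max{|U_i*|,|V_i*|} ≥ k(s+t) + 2t` or `min{|U_i*|,|V_i*|} ≥ (k+1)(s+t)`. -/
theorem claim_main {V : Type*} [Fintype V] [DecidableEq V]
    (G : SimpleGraph V) (s t k : ℕ) (U0 U1 U2 V0 V1 V2 : Finset V)
    (hH : StructH G s t k U0 U1 U2 V0 V1 V2)
    (𝒯 : Finset (Finset V × Finset V))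
    (h𝒯 : IsKstTiling G s t 𝒯)
    (F1 F2 : Finset (Finset V × Finset V))
    (hF1 : F1 = 𝒯.filter fun P => ((P.1 ∪ P.2) ∩ (U1 ∪ V1)).Nonempty)
    (hF2 : F2 = 𝒯.filter fun P => ((P.1 ∪ P.2) ∩ (U2 ∪ V2)).Nonempty)
    (U1s V1s U2s V2s : Finset V)
    (hU1s : U1s = (F1.biUnion fun P => P.1 ∪ P.2) ∩ (U0 ∪ U1 ∪ U2))
    (hV1s : V1s = (F1.biUnion fun P => P.1 ∪ P.2) ∩ (V0 ∪ V1 ∪ V2))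
    (hU2s : U2s = (F2.biUnion fun P => P.1 ∪ P.2) ∩ (U0 ∪ U1 ∪ U2))
    (hV2s : V2s = (F2.biUnion fun P => P.1 ∪ P.2) ∩ (V0 ∪ V1 ∪ V2)) :
    (k * (s + t) + 2 * t ≤ max U1s.card V1s.card ∨
      (k + 1) * (s + t) ≤ min U1s.card V1s.card) ∧
    (k * (s + t) + 2 * t ≤ max U2s.card V2s.card ∨
      (k + 1) * (s + t) ≤ min U2s.card V2s.card) := by
  have hs := hH.hs
  have ht := hH.ht
  have hU1 := hH.cardU1
  have hV1 := hH.cardV1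
  have hU2 := hH.cardU2
  have hV2 := hH.cardV2
  subst hU1s hV1s hU2s hV2s
  constructor
  · exact h𝒯.le_max_or_le_min_card hH.bip hs hH.hst (by grind) (by grind) (by omega) (by omega) hF1
  · exact h𝒯.le_max_or_le_min_card hH.bip hs hH.hst (by grind) (by grind) (by omega) (by omega) hF2

end PaperTiling
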